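/- The empirical saddle-point problem is equivalent to minimizing the pairwise least-squares AUC objective: ⨅_{(w,a,b) ∈ EuclideanSpace ℝ (Fin d) × ℝ × ℝ} ⨆_{α ∈ ℝ} Σ_{t=1}^{T} f_t(w, a, b, α) = (T₊·T₋/T)·((⨅_{w ∈ EuclideanSpace ℝ (Fin d)} F(w)) - 1). -/

import Mathlib

open scoped RealInnerProductSpace
open Finset

/-- Number of positively labeled samples. -/
def numPos (T : ℕ) (y : Fin T → ℤ) : ℕ := (Finset.univ.filter fun t => y t = 1).card

/-- Number of negatively labeled samples. -/
def numNeg (T : ℕ) (y : Fin T → ℤ) : ℕ := (Finset.univ.filter fun t => y t = -1).card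

/-- The mean of the positively labeled samples. -/
noncomputable def meanPos (d T : ℕ) (x : Fin T → EuclideanSpace ℝ (Fin d))
    (y : Fin T → ℤ) : EuclideanSpace ℝ (Fin d) :=
  ((numPos T y : ℝ))⁻¹ • ∑ t ∈ Finset.univ.filter fun t => y t = 1, x t

/-- The mean of the negatively labeled samples. -/
noncomputable def meanNeg (d T : ℕ) (x : Fin T → EuclideanSpace ℝ (Fin d))
    (y : Fin T → ℤ) : EuclideanSpace ℝ (Fin d) :=
  ((numNeg T y : ℝ))⁻¹ • ∑ t ∈ Finset.univ.filter fun t => y t = -1, x t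

/-- The per-sample loss `f_t(w, a, b, α)` of the empirical saddle-point reformulation,
where `p = T₊ / T`. -/
noncomputable def fsad (d T : ℕ) (x : Fin T → EuclideanSpace ℝ (Fin d)) (y : Fin T → ℤ)
    (w : EuclideanSpace ℝ (Fin d)) (a b α : ℝ) (t : Fin T) : ℝ :=
  let p : ℝ := (numPos T y : ℝ) / (T : ℝ)
  (1 - p) * (⟪w, x t⟫ - a) ^ 2 * (if y t = 1 then (1 : ℝ) else 0)
    + p * (⟪w, x t⟫ - b) ^ 2 * (if y t = -1 then (1 : ℝ) else 0)
    - p * (1 - p) * α ^ 2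
    + 2 * (1 + α) * ⟪w, x t⟫ *
        (p * (if y t = -1 then (1 : ℝ) else 0) - (1 - p) * (if y t = 1 then (1 : ℝ) else 0))

/-- The pairwise least-squares AUC surrogate objective. -/
noncomputable def lsAUC (d T : ℕ) (x : Fin T → EuclideanSpace ℝ (Fin d))
    (y : Fin T → ℤ) (w : EuclideanSpace ℝ (Fin d)) : ℝ :=
  (1 / ((numPos T y : ℝ) * (numNeg T y : ℝ))) *
    ∑ s ∈ Finset.univ.filter fun s => y s = 1,
      ∑ t ∈ Finset.univ.filter fun t => y t = -1, (1 - ⟪w, x s - x t⟫) ^ 2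

section SaddlePoint

/-- `∑_{s ∈ A} ∑_{t ∈ B} (1 - (u s - u t))²` in terms of the first and second moments of `u`. -/
lemma sum_sum_one_sub_sub_sq {ι : Type*} (A B : Finset ι) (u : ι → ℝ) :
    ∑ s ∈ A, ∑ t ∈ B, (1 - (u s - u t)) ^ 2
      = #A * #B + #B * ∑ s ∈ A, u s ^ 2 + #A * ∑ t ∈ B, u t ^ 2 - 2 * #B * ∑ s ∈ A, u s
        + 2 * #A * ∑ t ∈ B, u t - 2 * (∑ s ∈ A, u s) * ∑ t ∈ B, u t := by
  have h : ∀ s t, (1 - (u s - u t)) ^ 2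
      = 1 + u s ^ 2 + u t ^ 2 - 2 * u s + 2 * u t - 2 * (u s * u t) := fun s t => by ring
  simp only [h, sum_add_distrib, sum_sub_distrib, sum_const, nsmul_eq_mul, ← mul_sum,
    ← sum_mul]
  ring

/-- `∑_{t ∈ A} (u t - a)²` in terms of the first and second moments of `u`. -/
lemma sum_sub_const_sq {ι : Type*} (A : Finset ι) (u : ι → ℝ) (a : ℝ) :
    ∑ t ∈ A, (u t - a) ^ 2 = ∑ t ∈ A, u t ^ 2 - 2 * a * ∑ t ∈ A, u t + #A * a ^ 2 := by
  simp only [sub_sq, sum_add_distrib, sum_sub_distrib, sum_const, nsmul_eq_mul, ← sum_mul,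
    ← mul_sum]
  ring

variable {d T : ℕ} (x : Fin T → EuclideanSpace ℝ (Fin d)) {y : Fin T → ℤ}

lemma numPos_add_numNeg (hy : ∀ t, y t = 1 ∨ y t = -1) : numPos T y + numNeg T y = T := by
  have h : (univ.filter fun t => y t = -1) = univ.filter fun t => ¬ y t = 1 :=
    filter_congr fun t _ => by rcases hy t with h | h <;> simp [h]
  rw [numPos, numNeg, h, card_filter_add_card_filter_not, card_univ, Fintype.card_fin]

lemma inner_meanPos (w : EuclideanSpace ℝ (Fin d)) :
    ⟪w, meanPos d T x y⟫ = (numPos T y : ℝ)⁻¹ * ∑ t ∈ univ.filter fun t => y t = 1, ⟪w, x t⟫ := by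
  rw [meanPos, real_inner_smul_right, inner_sum]

lemma inner_meanNeg (w : EuclideanSpace ℝ (Fin d)) :
    ⟪w, meanNeg d T x y⟫ = (numNeg T y : ℝ)⁻¹ * ∑ t ∈ univ.filter fun t => y t = -1, ⟪w, x t⟫ := by
  rw [meanNeg, real_inner_smul_right, inner_sum]

/-- Completing the squares in `a`, `b` and `α` in the saddle-point objective. -/
lemma sum_fsad_eq (hy : ∀ t, y t = 1 ∨ y t = -1) (hTp : 1 ≤ numPos T y) (hTn : 1 ≤ numNeg T y)
    (w : EuclideanSpace ℝ (Fin d)) (a b α : ℝ) :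
    ∑ t, fsad d T x y w a b α t = (numPos T y : ℝ) * (numNeg T y : ℝ) / (T : ℝ) *
      (lsAUC d T x y w - 1 + (a - ⟪w, meanPos d T x y⟫) ^ 2 + (b - ⟪w, meanNeg d T x y⟫) ^ 2
        - (α - (⟪w, meanNeg d T x y⟫ - ⟪w, meanPos d T x y⟫)) ^ 2) := by
  have hP : (numPos T y : ℝ) ≠ 0 := by positivity
  have hN : (numNeg T y : ℝ) ≠ 0 := by positivity
  have hPN : (numPos T y : ℝ) + numNeg T y ≠ 0 := by positivity
  have hT : (T : ℝ) = numPos T y + numNeg T y := by exact_mod_cast (numPos_add_numNeg hy).symm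
  have hsum : ∑ t, fsad d T x y w a b α t
      = (1 - (numPos T y : ℝ) / T) * ∑ t ∈ univ.filter fun t => y t = 1, (⟪w, x t⟫ - a) ^ 2
        + (numPos T y : ℝ) / T * ∑ t ∈ univ.filter fun t => y t = -1, (⟪w, x t⟫ - b) ^ 2
        - T * ((numPos T y : ℝ) / T * (1 - (numPos T y : ℝ) / T) * α ^ 2)
        + 2 * (1 + α) * ((numPos T y : ℝ) / T * ∑ t ∈ univ.filter fun t => y t = -1, ⟪w, x t⟫
          - (1 - (numPos T y : ℝ) / T) * ∑ t ∈ univ.filter fun t => y t = 1, ⟪w, x t⟫) := by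
    have hconst (c : ℝ) : (T : ℝ) * c = ∑ _t : Fin T, c := by simp
    rw [hconst]
    simp only [sum_filter, mul_sum, ← sum_add_distrib, ← sum_sub_distrib]
    refine sum_congr rfl fun t _ => ?_
    rw [fsad]
    split_ifs <;> ring
  have hcP : (#(univ.filter fun t => y t = 1) : ℝ) = numPos T y := rfl
  have hcN : (#(univ.filter fun t => y t = -1) : ℝ) = numNeg T y := rfl
  rw [hsum, lsAUC]
  simp only [inner_sub_right]
  rw [sum_sum_one_sub_sub_sq _ _ fun t => ⟪w, x t⟫, sum_sub_const_sq, sum_sub_const_sq,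
    inner_meanPos, inner_meanNeg, hcP, hcN, hT]
  field_simp
  ring

lemma iSup_sum_fsad_eq (hy : ∀ t, y t = 1 ∨ y t = -1) (hTp : 1 ≤ numPos T y)
    (hTn : 1 ≤ numNeg T y) (w : EuclideanSpace ℝ (Fin d)) (a b : ℝ) :
    ⨆ α : ℝ, ∑ t, fsad d T x y w a b α t = (numPos T y : ℝ) * (numNeg T y : ℝ) / (T : ℝ) *
      (lsAUC d T x y w - 1 + (a - ⟪w, meanPos d T x y⟫) ^ 2
        + (b - ⟪w, meanNeg d T x y⟫) ^ 2) := by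
  simp only [sum_fsad_eq x hy hTp hTn]
  refine IsLUB.ciSup_eq (IsGreatest.isLUB
    ⟨⟨⟪w, meanNeg d T x y⟫ - ⟪w, meanPos d T x y⟫, by simp⟩, ?_⟩)
  rintro _ ⟨α, rfl⟩
  exact mul_le_mul_of_nonneg_left (sub_le_self _ (sq_nonneg _)) (by positivity)

lemma lsAUC_nonneg (w : EuclideanSpace ℝ (Fin d)) : 0 ≤ lsAUC d T x y w :=
  mul_nonneg (by positivity) (sum_nonneg fun _ _ => sum_nonneg fun _ _ => sq_nonneg _)

end SaddlePoint

/-- The empirical saddle-point problem is equivalent to minimizing the pairwise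
least-squares AUC objective. -/
theorem iInf_iSup_sum_fsad_eq_iInf_lsAUC (d T : ℕ) (hd : 1 ≤ d) (hT : 1 ≤ T)
    (x : Fin T → EuclideanSpace ℝ (Fin d)) (y : Fin T → ℤ)
    (hy : ∀ t, y t = 1 ∨ y t = -1)
    (hTp : 1 ≤ numPos T y) (hTn : 1 ≤ numNeg T y) :
    (⨅ wab : EuclideanSpace ℝ (Fin d) × ℝ × ℝ,
        ⨆ α : ℝ, ∑ t, fsad d T x y wab.1 wab.2.1 wab.2.2 α t)
      = ((numPos T y : ℝ) * (numNeg T y : ℝ) / (T : ℝ)) *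
          ((⨅ w : EuclideanSpace ℝ (Fin d), lsAUC d T x y w) - 1) := by
  have hc : (0 : ℝ) < (numPos T y : ℝ) * (numNeg T y : ℝ) / (T : ℝ) := by positivity
  have hF : BddBelow (Set.range fun w => lsAUC d T x y w) :=
    ⟨0, by rintro _ ⟨w, rfl⟩; exact lsAUC_nonneg x w⟩
  simp only [iSup_sum_fsad_eq x hy hTp hTn]
  have hlower : ∀ wab : EuclideanSpace ℝ (Fin d) × ℝ × ℝ,
      (numPos T y : ℝ) * (numNeg T y : ℝ) / (T : ℝ) * ((⨅ w, lsAUC d T x y w) - 1)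
        ≤ (numPos T y : ℝ) * (numNeg T y : ℝ) / (T : ℝ) *
          (lsAUC d T x y wab.1 - 1 + (wab.2.1 - ⟪wab.1, meanPos d T x y⟫) ^ 2
            + (wab.2.2 - ⟪wab.1, meanNeg d T x y⟫) ^ 2) := fun wab => by
    refine mul_le_mul_of_nonneg_left ?_ hc.le
    linarith [ciInf_le hF wab.1, sq_nonneg (wab.2.1 - ⟪wab.1, meanPos d T x y⟫),
      sq_nonneg (wab.2.2 - ⟪wab.1, meanNeg d T x y⟫)]
  refine le_antisymm ?_ (le_ciInf hlower)
  rw [← div_le_iff₀' hc, le_sub_iff_add_le]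
  refine le_ciInf fun w => ?_
  rw [← le_sub_iff_add_le, div_le_iff₀' hc]
  refine (ciInf_le ⟨_, by rintro _ ⟨wab, rfl⟩; exact hlower wab⟩
    (w, ⟪w, meanPos d T x y⟫, ⟪w, meanNeg d T x y⟫)).trans_eq ?_
  simp
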